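/- Let n ≥ 1, m ≥ 1, p > 1, and let u = (u_1,…,u_m) be a C² stable solution of −Δu_i = |u|^{p−1} u_i on ℝⁿ. Then there is a constant C > 0, independent of R, such that for every R > 1: ∫_{B_R} |u|² dx ≤ C R^{n − 4/(p−1)}, where B_R is the ball of radius R centered at the origin. -/

import Mathlib

open MeasureTheory Metric Filter Real Set

noncomputable section

/-- `n`-dimensional Euclidean space. -/
abbrev Euc (n : ℕ) := EuclideanSpace ℝ (Fin n)

/-- Laplacian of a scalar function on Euclidean space. -/
def lap {n : ℕ} (f : Euc n → ℝ) (x : Euc n) : ℝ :=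
  ∑ i : Fin n, iteratedFDeriv ℝ 2 f x ![EuclideanSpace.single i 1, EuclideanSpace.single i 1]

/-- Stability (quadratic form) inequality for the second order Lane–Emden system, tested
against families of smooth compactly supported functions whose supports lie in `S`:
`Σ_i ∫ |u|^{p−1} φ_i² + (p−1) Σ_{i,j} ∫ |u|^{p−3} u_i u_j φ_i φ_j ≤ Σ_i ∫ |∇φ_i|²`.
(Since `‖u x‖ ^ (p−3)` is interpreted with `Real.rpow`, the term `|u|^{p−3} u_i u_j`
vanishes on the set where `u = 0`, for any `p > 1`.) -/
def Stable1 (n m : ℕ) (p : ℝ) (u : Euc n → EuclideanSpace ℝ (Fin m))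
    (S : Set (Euc n)) : Prop :=
  ∀ φ : Fin m → Euc n → ℝ,
    (∀ i, ContDiff ℝ (⊤ : ℕ∞) (φ i)) → (∀ i, HasCompactSupport (φ i)) →
    (∀ i, tsupport (φ i) ⊆ S) →
    (∑ i, ∫ x, ‖u x‖ ^ (p - 1) * (φ i x) ^ 2) +
      (p - 1) * ∑ i, ∑ j, ∫ x, ‖u x‖ ^ (p - 3) * u x i * u x j * φ i x * φ j x
      ≤ ∑ i, ∫ x, ‖gradient (φ i) x‖ ^ 2

open scoped Topology Convolution

/-- Convolving a bounded function with a normalised bump function keeps it bounded. -/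
theorem ContDiffBump.norm_normed_convolution_le {E F : Type*} [NormedAddCommGroup E]
    [NormedSpace ℝ E] [HasContDiffBump E] [FiniteDimensional ℝ E] [MeasurableSpace E]
    [BorelSpace E] [NormedAddCommGroup F] [NormedSpace ℝ F] [CompleteSpace F] {μ : Measure E}
    [μ.IsAddHaarMeasure] (b : ContDiffBump (0 : E)) {h : E → F} (hh : Continuous h) {C : ℝ}
    (hC : ∀ x, ‖h x‖ ≤ C) (x : E) :
    ‖(b.normed μ ⋆[ContinuousLinearMap.lsmul ℝ ℝ, μ] h) x‖ ≤ 3 * C := by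
  have := b.dist_normed_convolution_le (μ := μ) (x₀ := x) (ε := 2 * C)
    hh.aestronglyMeasurable (fun y _ => by
      rw [dist_eq_norm]; linarith [norm_sub_le (h y) (h x), hC x, hC y])
  rw [dist_eq_norm] at this
  linarith [norm_le_norm_add_norm_sub' ((b.normed μ ⋆[ContinuousLinearMap.lsmul ℝ ℝ, μ] h) x)
    (h x), hC x]

/-- A compactly supported `C¹` function is the pointwise limit, together with its derivative, of
smooth functions with uniformly bounded supports, values and derivatives. -/
theorem exists_smooth_approx {E : Type*} [NormedAddCommGroup E] [InnerProductSpace ℝ E]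
    [FiniteDimensional ℝ E] [MeasurableSpace E] [BorelSpace E] {g : E → ℝ}
    (hg : ContDiff ℝ 1 g) (hc : HasCompactSupport g) :
    ∃ (K : Set E) (B : ℝ) (φ : ℕ → E → ℝ), IsCompact K ∧
      (∀ k, ContDiff ℝ (⊤ : ℕ∞) (φ k)) ∧ (∀ k, tsupport (φ k) ⊆ K) ∧
      (∀ k x, |φ k x| ≤ B) ∧ (∀ k x, ‖fderiv ℝ (φ k) x‖ ≤ B) ∧
      (∀ x, Tendsto (fun k => φ k x) atTop (𝓝 (g x))) ∧
      (∀ x, Tendsto (fun k => fderiv ℝ (φ k) x) atTop (𝓝 (fderiv ℝ g x))) := by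
  let μ : Measure E := volume
  have hdc : Continuous (fderiv ℝ g) := hg.continuous_fderiv one_ne_zero
  obtain ⟨B₁, hB₁⟩ := hc.exists_bound_of_continuous hg.continuous
  obtain ⟨B₂, hB₂⟩ := (hc.fderiv ℝ).exists_bound_of_continuous hdc
  let b : ℕ → ContDiffBump (0 : E) := fun k =>
    ⟨1 / (2 * ((k : ℝ) + 1)), 1 / ((k : ℝ) + 1), by positivity, by
      apply one_div_lt_one_div_of_lt <;> nlinarith [(Nat.cast_nonneg k : (0 : ℝ) ≤ k)]⟩
  have hb : Tendsto (fun k => (b k).rOut) atTop (𝓝 0) := tendsto_one_div_add_atTop_nhds_zero_nat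
  have hb1 : ∀ k, (b k).rOut ≤ 1 := fun k => by
    change 1 / ((k : ℝ) + 1) ≤ 1
    rw [div_le_one (by positivity)]
    linarith [(Nat.cast_nonneg k : (0 : ℝ) ≤ k)]
  have hloc : LocallyIntegrable g μ := hg.continuous.locallyIntegrable
  have hbloc : ∀ k, LocallyIntegrable ((b k).normed μ) μ := fun k =>
    ((b k).contDiff_normed (n := 0)).continuous.locallyIntegrable
  let φ : ℕ → E → ℝ := fun k => (b k).normed μ ⋆[ContinuousLinearMap.lsmul ℝ ℝ, μ] g
  have hfd : ∀ k x, fderiv ℝ (φ k) x =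
      ((b k).normed μ ⋆[ContinuousLinearMap.lsmul ℝ ℝ, μ] fderiv ℝ g) x := fun k x =>
    (hc.hasFDerivAt_convolution_right (ContinuousLinearMap.lsmul ℝ ℝ) (hbloc k) hg x).fderiv
  refine ⟨cthickening 1 (tsupport g), max (3 * B₁) (3 * B₂), φ, hc.isCompact.cthickening,
    fun k => (b k).hasCompactSupport_normed.contDiff_convolution_left _ (b k).contDiff_normed hloc,
    fun k => ?_, fun k x => ((b k).norm_normed_convolution_le hg.continuous hB₁ x).trans (le_max_left _ _),
    fun k x => ?_, fun x => ?_, fun x => ?_⟩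
  · refine closure_minimal ((support_convolution_subset _).trans ?_) isClosed_cthickening
    rintro _ ⟨y, hy, z, hz, rfl⟩
    rw [(b k).support_normed_eq, mem_ball_zero_iff] at hy
    refine mem_cthickening_of_dist_le (y + z) z 1 _ (subset_tsupport _ hz) ?_
    simpa [dist_eq_norm] using hy.le.trans (hb1 k)
  · rw [hfd]
    exact ((b k).norm_normed_convolution_le hdc hB₂ x).trans (le_max_right _ _)
  · exact ContDiffBump.convolution_tendsto_right_of_continuous hb hg.continuous x
  · simp_rw [hfd]
    exact ContDiffBump.convolution_tendsto_right_of_continuous hb hdc x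

/-- Dominated convergence for functions supported in a fixed compact set. -/
theorem tendsto_integral_of_dominated_on_compact {E : Type*} [TopologicalSpace E]
    [T2Space E] [MeasurableSpace E] [BorelSpace E] {μ : Measure E} [IsFiniteMeasureOnCompacts μ] {K : Set E} (hK : IsCompact K)
    {f : ℕ → E → ℝ} {F W : E → ℝ} (hW : Continuous W)
    (hm : ∀ k, AEStronglyMeasurable (f k) μ) (hbd : ∀ k x, |f k x| ≤ W x)
    (hs : ∀ k, ∀ x ∉ K, f k x = 0) (hl : ∀ x, Tendsto (fun k => f k x) atTop (𝓝 (F x))) :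
    Tendsto (fun k => ∫ x, f k x ∂μ) atTop (𝓝 (∫ x, F x ∂μ)) := by
  refine tendsto_integral_of_dominated_convergence (K.indicator W) hm ?_ ?_ (.of_forall hl)
  · exact (integrable_indicator_iff hK.measurableSet).2 (hW.continuousOn.integrableOn_compact hK)
  · refine fun k => .of_forall fun x => ?_
    by_cases hx : x ∈ K
    · simpa [hx] using hbd k x
    · simp [hx, hs k x hx]

theorem norm_gradient_eq_norm_fderiv {E : Type*} [NormedAddCommGroup E] [InnerProductSpace ℝ E]
    [CompleteSpace E] (f : E → ℝ) (x : E) : ‖gradient f x‖ = ‖fderiv ℝ f x‖ := by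
  rw [gradient, LinearIsometryEquiv.norm_map]

theorem norm_gradient_sq_eq_sum {n : ℕ} (f : Euc n → ℝ) (x : Euc n) :
    ‖gradient f x‖ ^ 2 = ∑ j, (fderiv ℝ f x (EuclideanSpace.single j 1)) ^ 2 := by
  rw [EuclideanSpace.real_norm_sq_eq]
  refine Finset.sum_congr rfl fun j _ => ?_
  rw [← toDual_gradient, InnerProductSpace.toDual_apply_apply, EuclideanSpace.inner_single_right]
  simp

theorem lap_eq_sum_fderiv {n : ℕ} {f : Euc n → ℝ} (hf : ContDiff ℝ 2 f) (x : Euc n) :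
    lap f x = ∑ j, fderiv ℝ (fun y => fderiv ℝ f y (EuclideanSpace.single j 1)) x
      (EuclideanSpace.single j 1) := by
  refine Finset.sum_congr rfl fun j _ => ?_
  have hd : DifferentiableAt ℝ (fderiv ℝ f) x :=
    (hf.fderiv_right (m := 1) (by norm_num)).differentiable one_ne_zero x
  rw [iteratedFDeriv_two_apply, fderiv_clm_apply hd (differentiableAt_const _)]
  simp

theorem Continuous.integrable_of_eq_zero_of_notMem_tsupport {n : ℕ} {f η : Euc n → ℝ}
    (hf : Continuous f) (hη : HasCompactSupport η) (h : ∀ x ∉ tsupport η, f x = 0) :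
    Integrable f :=
  hf.integrable_of_hasCompactSupport (HasCompactSupport.intro hη.isCompact h)

/-- Integration of `|∇(f η)|² = ∇f · ∇(f η²) + f² |∇η|²`. -/
theorem integral_norm_gradient_mul_sq {n : ℕ} {f η : Euc n → ℝ} (hf : ContDiff ℝ 2 f)
    (hη : ContDiff ℝ 1 η) (hc : HasCompactSupport η) :
    ∫ x, ‖gradient (fun y => f y * η y) x‖ ^ 2 =
      (∫ x, -lap f x * f x * η x ^ 2) + ∫ x, f x ^ 2 * ‖gradient η x‖ ^ 2 := by
  let e : Fin n → Euc n := fun j => EuclideanSpace.single j 1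
  let w : Euc n → ℝ := fun y => f y * η y ^ 2
  have hf1 : ContDiff ℝ 1 f := hf.of_le (by norm_num)
  have hw : ContDiff ℝ 1 w := hf1.mul (hη.pow 2)
  have hdf := hf1.differentiable one_ne_zero
  have hdη := hη.differentiable one_ne_zero
  have hD : ∀ j, ContDiff ℝ 1 (fun y => fderiv ℝ f y (e j)) := fun j =>
    (hf.fderiv_right (m := 1) (by norm_num)).clm_apply contDiff_const
  have hcD : ∀ j, Continuous fun y => fderiv ℝ (fun y => fderiv ℝ f y (e j)) y (e j) := fun j =>
    ((hD j).continuous_fderiv one_ne_zero).clm_apply continuous_const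
  have hcw : ∀ j, Continuous fun y => fderiv ℝ w y (e j) := fun j =>
    (hw.continuous_fderiv one_ne_zero).clm_apply continuous_const
  have hcη : Continuous fun y => ‖gradient η y‖ := by
    simp_rw [norm_gradient_eq_norm_fderiv]
    exact (hη.continuous_fderiv one_ne_zero).norm
  have hη0 : ∀ x ∉ tsupport η, η x = 0 := fun x hx => image_eq_zero_of_notMem_tsupport hx
  have hη1 : ∀ x ∉ tsupport η, fderiv ℝ η x = 0 := fun x hx =>
    fderiv_of_notMem_tsupport ℝ hx
  have hdw : ∀ x v, fderiv ℝ w x v =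
      η x ^ 2 * fderiv ℝ f x v + 2 * f x * η x * fderiv ℝ η x v := fun x v => by
    have := (hdf x).hasFDerivAt.mul ((hdη x).hasFDerivAt.pow 2)
    rw [HasFDerivAt.fderiv (f := w) this]
    simp
    ring
  have hdp : ∀ x v, fderiv ℝ (fun y => f y * η y) x v =
      η x * fderiv ℝ f x v + f x * fderiv ℝ η x v := fun x v => by
    rw [fderiv_fun_mul (hdf x) (hdη x)]
    simp
    ring
  have hpt : ∀ x, ‖gradient (fun y => f y * η y) x‖ ^ 2 =
      (∑ j, fderiv ℝ f x (e j) * fderiv ℝ w x (e j)) + f x ^ 2 * ‖gradient η x‖ ^ 2 := fun x => by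
    rw [norm_gradient_sq_eq_sum, norm_gradient_sq_eq_sum, Finset.mul_sum, ← Finset.sum_add_distrib]
    refine Finset.sum_congr rfl fun j _ => ?_
    rw [hdp, hdw]
    ring
  have hw0 : ∀ x ∉ tsupport η, w x = 0 := fun x hx => by simp [w, hη0 x hx]
  have hw1 : ∀ x v, x ∉ tsupport η → fderiv ℝ w x v = 0 := fun x v hx => by
    simp [hdw, hη0 x hx]
  have hi1 : ∀ j, Integrable fun x => fderiv ℝ f x (e j) * fderiv ℝ w x (e j) := fun j =>
    ((hD j).continuous.mul (hcw j)).integrable_of_eq_zero_of_notMem_tsupport hc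
      fun x hx => by simp [hw1 x _ hx]
  have hi2 : ∀ j, Integrable fun x => fderiv ℝ (fun y => fderiv ℝ f y (e j)) x (e j) * w x :=
    fun j => ((hcD j).mul hw.continuous).integrable_of_eq_zero_of_notMem_tsupport hc
      fun x hx => by simp [hw0 x hx]
  have hparts : ∀ j, ∫ x, fderiv ℝ f x (e j) * fderiv ℝ w x (e j) =
      -∫ x, fderiv ℝ (fun y => fderiv ℝ f y (e j)) x (e j) * w x := fun j => by
    refine integral_mul_fderiv_eq_neg_fderiv_mul_of_integrable (hi2 j) (hi1 j) ?_
      (fun x _ => (hD j).differentiable one_ne_zero x)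
      (fun x _ => hw.differentiable one_ne_zero x)
    exact ((hD j).continuous.mul hw.continuous).integrable_of_eq_zero_of_notMem_tsupport hc
      fun x hx => by simp [hw0 x hx]
  simp_rw [hpt]
  rw [integral_add (integrable_finsetSum _ fun j _ => hi1 j), integral_finsetSum _ fun j _ => hi1 j]
  · congr 1
    simp_rw [hparts]
    rw [Finset.sum_neg_distrib, ← integral_finsetSum _ fun j _ => hi2 j, ← integral_neg]
    refine integral_congr_ae (.of_forall fun x => ?_)
    simp only [lap_eq_sum_fderiv hf, ← Finset.sum_mul, w, e]
    ring
  · refine ((hf.continuous.pow 2).mul (hcη.pow 2)).integrable_of_eq_zero_of_notMem_tsupport hc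
      fun x hx => ?_
    simp [norm_gradient_eq_norm_fderiv, hη1 x hx]

theorem abs_norm_rpow_mul_apply_mul_apply_le {m : ℕ} (p : ℝ) (v : EuclideanSpace ℝ (Fin m))
    (i j : Fin m) : |‖v‖ ^ (p - 3) * v i * v j| ≤ ‖v‖ ^ (p - 1) := by
  rcases eq_or_ne v 0 with rfl | hv
  · simpa using Real.rpow_nonneg le_rfl _
  · have hv' : 0 < ‖v‖ := norm_pos_iff.2 hv
    have hi := PiLp.norm_apply_le v i
    have hj := PiLp.norm_apply_le v j
    rw [Real.norm_eq_abs] at hi hj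
    rw [abs_mul, abs_mul, abs_of_nonneg (Real.rpow_nonneg hv'.le _), mul_assoc,
      show p - 1 = p - 3 + (2 : ℕ) by push_cast; ring, Real.rpow_add_natCast hv'.ne', sq]
    gcongr

/-- The stability inequality extends to compactly supported `C¹` test functions. -/
theorem Stable1.le_of_contDiff_one {n m : ℕ} {p : ℝ} (hp : 1 < p)
    {u : Euc n → EuclideanSpace ℝ (Fin m)} (hu : Continuous u) (h : Stable1 n m p u Set.univ)
    {g : Fin m → Euc n → ℝ} (hg : ∀ i, ContDiff ℝ 1 (g i)) (hc : ∀ i, HasCompactSupport (g i)) :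
    (∑ i, ∫ x, ‖u x‖ ^ (p - 1) * (g i x) ^ 2) +
      (p - 1) * ∑ i, ∑ j, ∫ x, ‖u x‖ ^ (p - 3) * u x i * u x j * g i x * g j x
      ≤ ∑ i, ∫ x, ‖gradient (g i) x‖ ^ 2 := by
  choose K B φ hK hsm hsupp hb hb' hl hl' using fun i => exists_smooth_approx (hg i) (hc i)
  have hW : Continuous fun x => ‖u x‖ ^ (p - 1) :=
    hu.norm.rpow_const fun _ => Or.inr (by linarith)
  have hW0 : ∀ x, 0 ≤ ‖u x‖ ^ (p - 1) := fun x => Real.rpow_nonneg (norm_nonneg _) _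
  have hcφ : ∀ i k, Continuous (φ i k) := fun i k => (hsm i k).continuous
  have hB : ∀ i, 0 ≤ B i := fun i => (abs_nonneg _).trans (hb i 0 0)
  have h0 : ∀ i k, ∀ x ∉ K i, φ i k x = 0 := fun i k x hx =>
    image_eq_zero_of_notMem_tsupport fun hx' => hx (hsupp i k hx')
  have hw : ∀ i j, Measurable fun x => ‖u x‖ ^ (p - 3) * u x i * u x j := fun i j => by
    have h1 : ∀ i, Continuous fun x => u x i := fun i => by fun_prop
    exact ((hu.norm.measurable.pow_const _).mul (h1 i).measurable).mul (h1 j).measurable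
  refine le_of_tendsto_of_tendsto' (b := atTop) (Tendsto.add (tendsto_finsetSum _ fun i _ => ?_)
    (Tendsto.const_mul _ (tendsto_finsetSum _ fun i _ => tendsto_finsetSum _ fun j _ => ?_)))
    (tendsto_finsetSum _ fun i _ => ?_)
    fun k => h (fun i => φ i k) (fun i => hsm i k)
      (fun i => (hK i).of_isClosed_subset (isClosed_tsupport _) (hsupp i k)) fun i => subset_univ _
  · refine tendsto_integral_of_dominated_on_compact (hK i) (W := fun x => ‖u x‖ ^ (p - 1) * B i ^ 2)
      (by fun_prop) (fun k => ?_) (fun k x => ?_) (fun k x hx => by simp [h0 i k x hx])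
      fun x => ((hl i x).pow 2).const_mul _
    · exact (hW.mul ((hcφ i k).pow 2)).aestronglyMeasurable
    · rw [abs_mul, abs_pow, abs_of_nonneg (hW0 x)]
      have := hW0 x
      gcongr
      exact hb i k x
  · refine tendsto_integral_of_dominated_on_compact (hK i)
      (W := fun x => ‖u x‖ ^ (p - 1) * B i * B j)
      (by fun_prop) (fun k => ?_) (fun k x => ?_) (fun k x hx => by simp [h0 i k x hx])
      fun x => ((hl i x).const_mul _).mul (hl j x)
    · exact (((hw i j).mul (hcφ i k).measurable).mul (hcφ j k).measurable).aestronglyMeasurable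
    · rw [abs_mul, abs_mul]
      have := hW0 x
      have := hB i
      gcongr
      · exact abs_norm_rpow_mul_apply_mul_apply_le p (u x) i j
      · exact hb i k x
      · exact hb j k x
  · simp_rw [norm_gradient_eq_norm_fderiv]
    refine tendsto_integral_of_dominated_on_compact (hK i) (W := fun _ => B i ^ 2)
      (by fun_prop) (fun k => ?_) (fun k x => ?_) (fun k x hx => ?_)
      fun x => (hl' i x).norm.pow 2
    · exact (((hsm i k).continuous_fderiv (by simp)).norm.pow 2).aestronglyMeasurable
    · rw [abs_pow, abs_norm]
      gcongr
      exact hb' i k x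
    · simp [fderiv_of_notMem_tsupport ℝ fun hx' => hx (hsupp i k hx')]

/-- Energy estimate for stable solutions. -/
theorem Stable1.integral_norm_rpow_mul_sq_le {n m : ℕ} {p : ℝ} (hp : 1 < p)
    {u : Euc n → EuclideanSpace ℝ (Fin m)} (hreg : ContDiff ℝ 2 u)
    (hsol : ∀ (i : Fin m) (x : Euc n), - lap (fun z => u z i) x = ‖u x‖ ^ (p - 1) * u x i)
    (hstab : Stable1 n m p u Set.univ) {η : Euc n → ℝ} (hη : ContDiff ℝ 1 η)
    (hc : HasCompactSupport η) :
    (p - 1) * ∫ x, ‖u x‖ ^ (p + 1) * η x ^ 2 ≤ ∫ x, ‖u x‖ ^ 2 * ‖gradient η x‖ ^ 2 := by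
  have hui : ∀ i, ContDiff ℝ 2 fun x => u x i := fun i => by fun_prop
  have hui1 : ∀ i, ContDiff ℝ 1 fun x => u x i := fun i => (hui i).of_le (by norm_num)
  have hu := hreg.continuous
  have hη0 : ∀ x ∉ tsupport η, η x = 0 := fun x hx => image_eq_zero_of_notMem_tsupport hx
  have hη1 : ∀ x ∉ tsupport η, gradient η x = 0 := fun x hx => by
    rw [← norm_eq_zero, norm_gradient_eq_norm_fderiv, fderiv_of_notMem_tsupport ℝ hx, norm_zero]
  have hcη : Continuous fun y => ‖gradient η y‖ := by
    simp_rw [norm_gradient_eq_norm_fderiv]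
    exact (hη.continuous_fderiv one_ne_zero).norm
  have hW : Continuous fun x => ‖u x‖ ^ (p - 1) :=
    hu.norm.rpow_const fun _ => Or.inr (by linarith)
  have hsum : ∀ x, ∑ i, u x i ^ 2 = ‖u x‖ ^ 2 := fun x => (EuclideanSpace.real_norm_sq_eq _).symm
  have hpow : ∀ x, ‖u x‖ ^ (p - 1) * ‖u x‖ ^ 2 = ‖u x‖ ^ (p + 1) := fun x => by
    rw [← Real.rpow_natCast, ← Real.rpow_add' (norm_nonneg _) (by push_cast; linarith)]
    push_cast
    ring_nf
  have hpow' : ∀ x, ‖u x‖ ^ (p - 3) * ‖u x‖ ^ 4 = ‖u x‖ ^ (p + 1) := fun x => by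
    rw [← Real.rpow_natCast, ← Real.rpow_add' (norm_nonneg _) (by push_cast; linarith)]
    push_cast
    ring_nf
  have key := hstab.le_of_contDiff_one hp hu (g := fun i x => u x i * η x)
    (fun i => (hui1 i).mul hη) (fun i => hc.mul_left)
  have hi1 : ∀ i, Integrable fun x => ‖u x‖ ^ (p - 1) * (u x i * η x) ^ 2 := fun i =>
    (hW.mul (((hui i).continuous.mul hη.continuous).pow 2)).integrable_of_eq_zero_of_notMem_tsupport
      hc fun x hx => by simp [hη0 x hx]
  have hi2 : ∀ i j, Integrable fun x =>
      ‖u x‖ ^ (p - 3) * u x i * u x j * (u x i * η x) * (u x j * η x) := fun i j => by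
    refine Integrable.mono' (g := fun x => ‖u x‖ ^ (p - 1) * |u x i * η x| * |u x j * η x|)
      (Continuous.integrable_of_eq_zero_of_notMem_tsupport ?_ hc fun x hx => by simp [hη0 x hx])
      ?_ (.of_forall fun x => ?_)
    · exact (hW.mul ((hui i).continuous.mul hη.continuous).abs).mul
        ((hui j).continuous.mul hη.continuous).abs
    · have hm := fun i => (hui i).continuous.measurable
      exact (((((hu.norm.measurable.pow_const _).mul (hm i)).mul (hm j)).mul
        ((hm i).mul hη.continuous.measurable)).mul
        ((hm j).mul hη.continuous.measurable)).aestronglyMeasurable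
    · rw [Real.norm_eq_abs, abs_mul, abs_mul]
      gcongr
      exact abs_norm_rpow_mul_apply_mul_apply_le p (u x) i j
  have hi3 : ∀ i, Integrable fun x => u x i ^ 2 * ‖gradient η x‖ ^ 2 := fun i =>
    (((hui i).continuous.pow 2).mul (hcη.pow 2)).integrable_of_eq_zero_of_notMem_tsupport hc
      fun x hx => by simp [hη1 x hx]
  have e1 : ∑ i, ∫ x, ‖u x‖ ^ (p - 1) * (u x i * η x) ^ 2 =
      ∫ x, ‖u x‖ ^ (p + 1) * η x ^ 2 := by
    rw [← integral_finsetSum _ fun i _ => hi1 i]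
    refine integral_congr_ae (.of_forall fun x => ?_)
    simp only [mul_pow, ← Finset.mul_sum, ← Finset.sum_mul, hsum, ← mul_assoc, hpow]
  have e2 : ∑ i, ∑ j, ∫ x, ‖u x‖ ^ (p - 3) * u x i * u x j * (u x i * η x) * (u x j * η x) =
      ∫ x, ‖u x‖ ^ (p + 1) * η x ^ 2 := by
    simp_rw [← integral_finsetSum _ fun j _ => hi2 _ j]
    rw [← integral_finsetSum _ fun i _ => integrable_finsetSum _ fun j _ => hi2 i j]
    refine integral_congr_ae (.of_forall fun x => ?_)
    have : ∀ i j, ‖u x‖ ^ (p - 3) * u x i * u x j * (u x i * η x) * (u x j * η x) =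
        ‖u x‖ ^ (p - 3) * η x ^ 2 * (u x i ^ 2 * u x j ^ 2) := fun i j => by ring
    simp only [this, ← Finset.mul_sum, ← Finset.sum_mul, hsum]
    rw [← hpow']
    ring
  have e3 : ∑ i, ∫ x, ‖gradient (fun y => u y i * η y) x‖ ^ 2 =
      (∫ x, ‖u x‖ ^ (p + 1) * η x ^ 2) + ∫ x, ‖u x‖ ^ 2 * ‖gradient η x‖ ^ 2 := by
    simp_rw [integral_norm_gradient_mul_sq (hui _) hη hc, hsol]
    rw [Finset.sum_add_distrib, ← integral_finsetSum _ fun i _ => hi3 i, ← e1]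
    congr 1
    · refine Finset.sum_congr rfl fun i _ => integral_congr_ae (.of_forall fun x => ?_)
      ring
    · refine integral_congr_ae (.of_forall fun x => ?_)
      simp only [← Finset.sum_mul, hsum]
  rw [e1, e2, e3] at key
  linarith

/-- A Young type inequality with an explicit weight. -/
theorem mul_sq_mul_pow_le {p a s c : ℝ} {k : ℕ} (hp : 1 < p) (ha : 0 ≤ a) (hs : 0 ≤ s)
    (hs1 : s ≤ 1) (hc : 0 ≤ c) (hk : 4 / (p - 1) ≤ 2 * k) :
    c * a ^ 2 * s ^ (2 * k) ≤ a ^ (p + 1) * s ^ (2 * (k + 1)) + c * c ^ (2 / (p - 1)) := by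
  have hq : 0 < p - 1 := by linarith
  have hsplit : a ^ (p + 1) = a ^ (p - 1) * a ^ 2 := by
    rw [← Real.rpow_natCast, ← Real.rpow_add' ha (by push_cast; linarith)]
    push_cast
    ring_nf
  rcases le_total c (a ^ (p - 1) * s ^ 2) with h | h
  · calc c * a ^ 2 * s ^ (2 * k) ≤ (a ^ (p - 1) * s ^ 2) * a ^ 2 * s ^ (2 * k) := by gcongr
      _ = a ^ (p + 1) * s ^ (2 * (k + 1)) := by rw [hsplit]; ring
      _ ≤ _ := le_add_of_nonneg_right (by positivity)
  · have h1 : a ^ 2 * s ^ (2 * k) ≤ c ^ (2 / (p - 1)) := by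
      calc a ^ 2 * s ^ (2 * k) ≤ a ^ 2 * s ^ (4 / (p - 1)) := by
            gcongr
            rw [← Real.rpow_natCast]
            exact Real.rpow_le_rpow_of_exponent_ge' hs hs1 (by positivity) (by exact_mod_cast hk)
        _ = (a ^ (p - 1) * s ^ 2) ^ (2 / (p - 1)) := by
            rw [Real.mul_rpow (by positivity) (by positivity), ← Real.rpow_mul ha,
              ← Real.rpow_natCast s, ← Real.rpow_mul hs, mul_div_cancel₀ _ hq.ne',
              ← Real.rpow_natCast a]
            push_cast
            ring_nf
        _ ≤ _ := by gcongr
    calc c * a ^ 2 * s ^ (2 * k) = c * (a ^ 2 * s ^ (2 * k)) := by ring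
      _ ≤ c * c ^ (2 / (p - 1)) := by gcongr
      _ ≤ _ := le_add_of_nonneg_left (by positivity)

/-- Rescaled cutoff functions on Euclidean space. -/
theorem exists_cutoff (n : ℕ) : ∃ M : ℝ, 0 ≤ M ∧ ∀ R : ℝ, 0 < R → ∃ ψ : Euc n → ℝ,
    ContDiff ℝ 1 ψ ∧ (∀ x, 0 ≤ ψ x) ∧ (∀ x, ψ x ≤ 1) ∧ (∀ x ∈ ball 0 R, ψ x = 1) ∧
    (∀ x ∉ closedBall 0 (2 * R), ψ x = 0) ∧ ∀ x, ‖fderiv ℝ ψ x‖ ≤ M * R⁻¹ := by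
  let χ : ContDiffBump (0 : Euc n) := ⟨1, 2, one_pos, one_lt_two⟩
  have hχ : ContDiff ℝ 1 χ := χ.contDiff
  obtain ⟨M, hM⟩ := (χ.hasCompactSupport.fderiv ℝ).exists_bound_of_continuous
    (hχ.continuous_fderiv one_ne_zero)
  refine ⟨M, (norm_nonneg _).trans (hM 0), fun R hR => ⟨fun x => χ (R⁻¹ • x),
    hχ.comp (contDiff_const_smul _), fun x => χ.nonneg, fun x => χ.le_one, fun x hx => ?_,
    fun x hx => ?_, fun x => ?_⟩⟩
  · apply χ.one_of_mem_closedBall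
    rw [mem_ball_zero_iff] at hx
    rw [mem_closedBall_zero_iff, norm_smul, norm_inv, Real.norm_of_nonneg hR.le, inv_mul_le_iff₀ hR]
    simpa [χ] using hx.le
  · apply χ.zero_of_le_dist
    rw [mem_closedBall_zero_iff, not_le] at hx
    rw [dist_zero_right, norm_smul, norm_inv, Real.norm_of_nonneg hR.le, le_inv_mul_iff₀ hR,
      mul_comm]
    exact hx.le
  · rw [fderiv_comp_smul, norm_smul, norm_inv, Real.norm_of_nonneg hR.le, mul_comm]
    gcongr
    exact hM _

/-- Corollary 2.3: the `L²` estimate `∫_{B_R} |u|² ≤ C R^{n−4/(p−1)}`, `R > 1`, for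
stable solutions of `−Δu_i = |u|^{p−1} u_i`. -/
theorem statement7 (n m : ℕ) (hn : 1 ≤ n) (hm : 1 ≤ m) (p : ℝ) (hp : 1 < p)
    (u : Euc n → EuclideanSpace ℝ (Fin m)) (hreg : ContDiff ℝ 2 u)
    (hsol : ∀ (i : Fin m) (x : Euc n), - lap (fun z => u z i) x = ‖u x‖ ^ (p - 1) * u x i)
    (hstab : Stable1 n m p u Set.univ) :
    ∃ C : ℝ, 0 < C ∧ ∀ R : ℝ, 1 < R →
      (∫ x in ball (0 : Euc n) R, ‖u x‖ ^ 2) ≤ C * R ^ ((n : ℝ) - 4 / (p - 1)) := by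
  have hq : 0 < p - 1 := by linarith
  have hu := hreg.continuous
  obtain ⟨M, hM, hcut⟩ := exists_cutoff n
  obtain ⟨k, hk⟩ := exists_nat_ge (4 / (p - 1))
  have hk0 : k ≠ 0 := by
    rintro rfl
    exact absurd hk (not_le.2 (by simpa using hq))
  have hk2 : 4 / (p - 1) ≤ 2 * k := hk.trans (by linarith [(Nat.cast_nonneg k : (0 : ℝ) ≤ k)])
  let K : ℝ := ((k + 1) * M) ^ 2
  let c : ℝ := 2 * K / (p - 1)
  have hc : 0 ≤ c := by positivity
  let V : ℝ := volume.real (ball (0 : Euc n) 1)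
  have hV : 0 ≤ V := measureReal_nonneg
  refine ⟨(c * c ^ (2 / (p - 1)) + 1) * (2 ^ n * V) + 1, by positivity, fun R hR => ?_⟩
  have hR0 : 0 < R := by linarith
  obtain ⟨ψ, hψ, hψ0, hψ1, hψB, hψS, hψM⟩ := hcut R hR0
  let S : Set (Euc n) := closedBall 0 (2 * R)
  have hS : volume.real S = 2 ^ n * V * R ^ n := by
    rw [Measure.addHaar_real_closedBall _ _ (by positivity)]
    simp [V, mul_pow]
    ring
  have hSm : MeasurableSet S := measurableSet_closedBall
  have hconst : ∀ t : ℝ, Integrable (S.indicator fun _ => t) := fun t =>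
    (integrable_indicator_iff hSm).2
      (continuousOn_const.integrableOn_compact (isCompact_closedBall _ _))
  have hconst' : ∀ t : ℝ, ∫ x, S.indicator (fun _ => t) x = volume.real S * t := fun t => by
    rw [integral_indicator hSm, setIntegral_const, smul_eq_mul]
  let η : Euc n → ℝ := fun x => ψ x ^ (k + 1)
  have hη : ContDiff ℝ 1 η := hψ.pow _
  have hη0 : ∀ x ∉ S, η x = 0 := fun x hx => by simp [η, hψS x hx]
  have hηc : HasCompactSupport η := HasCompactSupport.intro (isCompact_closedBall _ _) hη0
  have hgrad : ∀ x, ‖gradient η x‖ ^ 2 ≤ K * R⁻¹ ^ 2 * ψ x ^ (2 * k) := fun x => by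
    have : fderiv ℝ η x = ((k + 1 : ℕ) * ψ x ^ k) • fderiv ℝ ψ x := by
      have := ((hψ.differentiable one_ne_zero x).hasFDerivAt.pow (k + 1)).fderiv
      simpa using this
    rw [norm_gradient_eq_norm_fderiv, this, norm_smul, norm_mul, norm_pow,
      Real.norm_of_nonneg (hψ0 x)]
    calc (‖((k + 1 : ℕ) : ℝ)‖ * ψ x ^ k * ‖fderiv ℝ ψ x‖) ^ 2
        ≤ ((k + 1) * ψ x ^ k * (M * R⁻¹)) ^ 2 := by
          have := hψ0 x
          gcongr
          · rw [Real.norm_natCast, Nat.cast_succ]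
          · exact hψM x
      _ = _ := by simp only [K]; ring
  let A : Euc n → ℝ := fun x => ‖u x‖ ^ (p + 1) * η x ^ 2
  have hA : Integrable A := by
    have : Continuous A :=
      (hu.norm.rpow_const fun _ => Or.inr (by linarith)).mul (hη.continuous.pow 2)
    exact this.integrable_of_hasCompactSupport
      (HasCompactSupport.intro (isCompact_closedBall 0 (2 * R)) fun x hx => by simp [A, hη0 x hx])
  have hA0 : ∀ x, 0 ≤ A x := fun x => by positivity
  have hAψ : ∀ x, ‖u x‖ ^ (p + 1) * ψ x ^ (2 * (k + 1)) = A x := fun x => by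
    simp only [A, η]; ring
  let d : ℝ := c * R⁻¹ ^ 2
  have hd : 0 ≤ d := by positivity
  have hI : ∫ x, A x ≤ volume.real S * (d * d ^ (2 / (p - 1))) := by
    have h1 : (p - 1) * ∫ x, A x ≤ _ :=
      hstab.integral_norm_rpow_mul_sq_le hp hreg hsol hη hηc
    have h2 : ∫ x, ‖u x‖ ^ 2 * ‖gradient η x‖ ^ 2 ≤
        ∫ x, (p - 1) / 2 * (A x + S.indicator (fun _ => d * d ^ (2 / (p - 1))) x) := by
      refine integral_mono_of_nonneg (.of_forall fun x => by positivity)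
        ((hA.add (hconst _)).const_mul _) (.of_forall fun x => ?_)
      have h3 := mul_le_mul_of_nonneg_left (hgrad x) (sq_nonneg ‖u x‖)
      by_cases hx : x ∈ S
      · have h4 := mul_sq_mul_pow_le hp (norm_nonneg (u x)) (hψ0 x) (hψ1 x) hd hk2
        rw [hAψ] at h4
        simp only [indicator_of_mem hx]
        refine h3.trans (le_trans (le_of_eq ?_) (mul_le_mul_of_nonneg_left h4 (by positivity)))
        simp only [d, c]
        field_simp
      · simp only [indicator_of_notMem hx, add_zero]
        refine h3.trans ?_
        rw [hψS x hx, zero_pow (by positivity)]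
        simpa using mul_nonneg (by positivity : 0 ≤ (p - 1) / 2) (hA0 x)
    rw [integral_const_mul, integral_add hA (hconst _), hconst'] at h2
    have h3 := h1.trans h2
    rw [div_mul_eq_mul_div, le_div_iff₀ two_pos, mul_assoc] at h3
    linarith [le_of_mul_le_mul_left h3 hq]
  let r : ℝ := R⁻¹ ^ 2
  have hr : 0 < r := by positivity
  have hfin : r * ∫ x in ball (0 : Euc n) R, ‖u x‖ ^ 2 ≤
      (∫ x, A x) + volume.real S * (r * r ^ (2 / (p - 1))) := by
    rw [← integral_indicator measurableSet_ball, ← integral_const_mul, ← hconst',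
      ← integral_add hA (hconst _)]
    refine integral_mono_of_nonneg (.of_forall fun x => ?_) (hA.add (hconst _))
      (.of_forall fun x => ?_)
    · exact mul_nonneg hr.le (indicator_nonneg (fun y _ => by positivity) x)
    · by_cases hx : x ∈ ball (0 : Euc n) R
      · have hxS : x ∈ S := ball_subset_closedBall (ball_subset_ball (by linarith) hx)
        have h4 := mul_sq_mul_pow_le hp (norm_nonneg (u x)) (hψ0 x) (hψ1 x) hr.le hk2
        rw [hAψ, hψB x hx, one_pow, mul_one] at h4
        simpa only [indicator_of_mem hx, indicator_of_mem hxS] using h4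
      · simp only [indicator_of_notMem hx, mul_zero]
        exact add_nonneg (hA0 x) (indicator_nonneg (fun y _ => by positivity) x)
  have hrR : r ^ (2 / (p - 1)) * R ^ n = R ^ ((n : ℝ) - 4 / (p - 1)) := by
    simp only [r]
    rw [← Real.rpow_natCast R⁻¹, ← Real.rpow_mul (by positivity), Real.inv_rpow hR0.le,
      ← Real.rpow_neg hR0.le, ← Real.rpow_natCast R n, ← Real.rpow_add hR0]
    push_cast
    ring_nf
  have hdr : d * d ^ (2 / (p - 1)) = c * c ^ (2 / (p - 1)) * (r * r ^ (2 / (p - 1))) := by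
    change c * r * (c * r) ^ (2 / (p - 1)) = _
    rw [Real.mul_rpow hc hr.le]
    ring
  have h5 : r * ∫ x in ball (0 : Euc n) R, ‖u x‖ ^ 2 ≤
      r * ((c * c ^ (2 / (p - 1)) + 1) * (2 ^ n * V) * R ^ ((n : ℝ) - 4 / (p - 1))) := by
    refine hfin.trans ((add_le_add_left hI _).trans (le_of_eq ?_))
    rw [hdr, hS, ← hrR]
    ring
  refine (le_of_mul_le_mul_left h5 hr).trans ?_
  gcongr
  linarith
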